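/- arXiv:2103.09119 — 4 statements merged into one kernel-verified Lean document; each statement's English description precedes it below -/
import Mathlib

section
/- Let q be an odd prime power with q > 3, F a finite field with q elements, a ∈ F a nonsquare (in particular a ≠ 0), and n an even natural number. Set d = gcd(n, q−1), δ = gcd(n, q+1), and let r be the 2-adic valuation of q²−1. Then the residue sum S_q(D_n(x,a)) equals T₁ + T₂ + T₃, where T₁ = 0 if 2^(r−1) divides n and T₁ = −(−1)^(n/d + n/δ)·a^(n/2) otherwise; T₂ = (−1)^(n/d)·a^(n/2) if d = q−1 and T₂ = 0 otherwise; and T₃ = (−1)^(n/δ)·a^(n/2) if δ = q+1 and T₃ = 0 otherwise. -/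
open Polynomial

theorem eval_add_dickson_one_mul {R : Type*} [CommRing R] (x y : R) (n : ℕ) :
    (dickson 1 (x * y) n).eval (x + y) = x ^ n + y ^ n := by
  induction n using Nat.twoStepInduction with
  | zero => simp [dickson_zero]; norm_num
  | one => simp
  | more n h0 h1 =>
    rw [dickson_add_two, eval_sub, eval_mul, eval_mul, eval_X, eval_C, h0, h1]
    ring

/-- An element of an extension fixed by the Frobenius of a finite field lies in that field. -/
theorem exists_algebraMap_eq_of_pow_card_eq {F L : Type*} [Field F] [Fintype F] [Field L]
    [Algebra F L] {z : L} (hz : z ^ Fintype.card F = z) : ∃ x : F, algebraMap F L x = z := by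
  have hne : (X ^ Fintype.card F - X : F[X]) ≠ 0 :=
    FiniteField.X_pow_card_sub_X_ne_zero F Fintype.one_lt_card
  have hs : (X ^ Fintype.card F - X : F[X]).Splits := by
    rw [splits_iff_card_roots, FiniteField.roots_X_pow_card_sub_X, ← Finset.card_def,
      Finset.card_univ, FiniteField.X_pow_card_sub_X_natDegree_eq F Fintype.one_lt_card]
  exact hs.mem_range_of_isRoot hne (by simp [hz])

/-- The image of `u ↦ u + e ^ 2 / u` on a finite set stable under `u ↦ e ^ 2 / u`: its fibres have
two elements except above the fixed points `u = ± e`. -/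
theorem sum_image_add_sq_div {L : Type*} [Field L] [DecidableEq L] {e : L}
    (he : e ≠ 0) (S : Finset L) (h0 : ∀ u ∈ S, u ≠ 0) (hS : ∀ u ∈ S, e ^ 2 / u ∈ S) :
    ∑ w ∈ S.image (fun u => u + e ^ 2 / u), w = ∑ u ∈ S, u + ∑ u ∈ S with u ^ 2 = e ^ 2, u := by
  rw [Finset.sum_filter, ← Finset.sum_add_distrib]
  refine Finset.sum_image' (f := fun w => w) _ fun u hu => ?_
  have hu0 := h0 u hu
  have hfib : S.filter (fun v => v + e ^ 2 / v = u + e ^ 2 / u) = {u, e ^ 2 / u} := by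
    ext v
    simp only [Finset.mem_filter, Finset.mem_insert, Finset.mem_singleton]
    constructor
    · rintro ⟨hv, h⟩
      have hv0 := h0 v hv
      field_simp at h
      have : (v - u) * (v * u - e ^ 2) = 0 := by linear_combination h
      rcases mul_eq_zero.mp this with h | h
      · exact Or.inl (sub_eq_zero.mp h)
      · exact Or.inr (by rw [eq_div_iff hu0]; exact sub_eq_zero.mp h)
    · rintro (rfl | rfl)
      · exact ⟨hu, rfl⟩
      · refine ⟨hS u hu, ?_⟩
        field_simp
        ring
  rw [hfib]
  by_cases h : u ^ 2 = e ^ 2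
  · have : e ^ 2 / u = u := by rw [← h]; field_simp
    simp [this, h]
  · have hne : u ≠ e ^ 2 / u := fun hh => h (by rw [eq_div_iff hu0] at hh; rw [← hh]; ring)
    have h' : ¬ (e ^ 2 / u) ^ 2 = e ^ 2 := by
      intro hh
      apply h
      have he2 : e ^ 2 ≠ 0 := pow_ne_zero _ he
      field_simp at hh
      exact hh.symm
    rw [Finset.sum_pair hne, if_neg h, if_neg h']
    ring

theorem sum_nthRootsFinset {L : Type*} [Field L] [IsAlgClosed L] {M : ℕ} (hM : (M : L) ≠ 0)
    (b : L) : ∑ u ∈ nthRootsFinset M b, u = if M = 1 then b else 0 := by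
  have hM0 : 0 < M := Nat.pos_of_ne_zero (by rintro rfl; simp at hM)
  split_ifs with h1
  · subst h1
    have : nthRootsFinset 1 b = {b} := by
      ext u; simp [mem_nthRootsFinset one_pos]
    simp [this]
  · have : NeZero (M : L) := ⟨hM⟩
    obtain ⟨ζ, hζ⟩ := HasEnoughRootsOfUnity.exists_primitiveRoot L M
    have key : ∑ u ∈ nthRootsFinset M b, u = ∑ u ∈ nthRootsFinset M b, ζ * u := by
      symm
      refine Finset.sum_bijective (fun u => ζ * u)
        (mulLeft_bijective₀ ζ (hζ.ne_zero hM0.ne')) (fun u => ?_) fun u _ => rfl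
      simp [mem_nthRootsFinset hM0, mul_pow, hζ.pow_eq_one]
    rw [← Finset.mul_sum] at key
    have : (1 - ζ) * ∑ u ∈ nthRootsFinset M b, u = 0 := by linear_combination key
    exact (mul_eq_zero.mp this).resolve_left
      (sub_ne_zero.mpr (hζ.ne_one (by omega)).symm)

theorem filter_sq_eq_nthRootsFinset {L : Type*} [Field L] [DecidableEq L] (h2 : (2 : L) ≠ 0)
    {M m : ℕ} (hM : 0 < M) (hcop : m.Coprime M) {c e : L} (hc : c ≠ 0)
    (he : e ^ M = (-c) ^ m) :
    (nthRootsFinset M (c ^ m)).filter (fun u => u ^ 2 = e ^ 2) =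
      if Odd M then {(-1) ^ m * e} else ∅ := by
  have hcm : c ^ m ≠ 0 := pow_ne_zero _ hc
  have h11 : (-1 : L) ≠ 1 := fun h => h2 (by linear_combination -h)
  rw [neg_pow] at he
  split_ifs with hodd
  · ext u
    simp only [Finset.mem_filter, mem_nthRootsFinset hM, Finset.mem_singleton,
      sq_eq_sq_iff_eq_or_eq_neg]
    rcases Nat.even_or_odd m with hm | hm
    · simp only [hm.neg_one_pow, one_mul] at he ⊢
      constructor
      · rintro ⟨h, rfl | rfl⟩
        · rfl
        · rw [hodd.neg_pow, he] at h
          exact absurd (mul_right_cancel₀ hcm (by rw [one_mul, neg_one_mul, h])) h11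
      · rintro rfl
        exact ⟨he, Or.inl rfl⟩
    · simp only [hm.neg_one_pow] at he ⊢
      constructor
      · rintro ⟨h, rfl | rfl⟩
        · rw [he] at h
          exact absurd (mul_right_cancel₀ hcm (by rw [one_mul, h])) h11
        · ring
      · rintro rfl
        refine ⟨?_, Or.inr (by ring)⟩
        rw [neg_one_mul, hodd.neg_pow, he, neg_one_mul, neg_neg]
  · rw [Nat.not_odd_iff_even] at hodd
    have hm : Odd m := by
      rw [← Nat.not_even_iff_odd]
      intro hm
      have := Nat.dvd_gcd hm.two_dvd hodd.two_dvd
      rw [hcop.gcd_eq_one] at this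
      omega
    refine Finset.filter_eq_empty_iff.mpr fun u hu h => ?_
    rw [mem_nthRootsFinset hM] at hu
    have hue : u ^ M = e ^ M := by
      obtain ⟨k, rfl⟩ := hodd.two_dvd
      rw [pow_mul, pow_mul, h]
    rw [hu, he, hm.neg_one_pow] at hue
    exact h11 (mul_right_cancel₀ hcm (by rw [one_mul, ← hue]))

/-- The `n`-th powers of the `N`-th roots of `c`. -/
theorem exists_pow_eq_iff_pow_div_gcd_eq {L : Type*} [Field L] [IsAlgClosed L] {N : ℕ}
    (hN : 0 < N) (n : ℕ) {c : L} (hc : c ≠ 0) (u : L) :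
    (∃ y, y ^ N = c ∧ y ^ n = u) ↔ u ^ (N / n.gcd N) = c ^ (n / n.gcd N) := by
  have hd : 0 < n.gcd N := Nat.gcd_pos_of_pos_right _ hN
  obtain ⟨k, hk⟩ := Nat.gcd_dvd_left n N
  obtain ⟨M, hM⟩ := Nat.gcd_dvd_right n N
  have hk' : n / n.gcd N = k := Nat.div_eq_of_eq_mul_right hd hk
  have hM' : N / n.gcd N = M := Nat.div_eq_of_eq_mul_right hd hM
  have hcross : n * M = N * k := by
    conv_lhs => rw [hk]
    conv_rhs => rw [hM]
    ring
  rw [hk', hM']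
  constructor
  · rintro ⟨y, hy, rfl⟩
    rw [← pow_mul, hcross, pow_mul, hy]
  · intro hu
    obtain ⟨y, hy⟩ := IsAlgClosed.exists_pow_nat_eq c hN
    have hy0 : y ≠ 0 := by rintro rfl; exact hc (by rw [← hy, zero_pow hN.ne'])
    obtain ⟨v, hv⟩ := IsAlgClosed.exists_pow_nat_eq (u / y ^ n) hd
    have hvN : v ^ N = 1 := by
      rw [hM, pow_mul, hv, div_pow, hu, ← pow_mul, hcross, pow_mul, hy,
        div_self (pow_ne_zero _ hc)]
    have hv0 : v ≠ 0 := by rintro rfl; simp [hN.ne'] at hvN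
    have hbez := Nat.gcd_eq_gcd_ab n N
    have hvn : (v ^ n.gcdA N) ^ n = u / y ^ n := by
      rw [← hv, ← zpow_natCast v (n.gcd N), hbez, zpow_add₀ hv0, zpow_mul v N, zpow_natCast v N,
        hvN, one_zpow, mul_one, ← zpow_natCast, ← zpow_mul, mul_comm]
    refine ⟨y * v ^ n.gcdA N, ?_, ?_⟩
    · rw [mul_pow, hy, ← zpow_natCast, ← zpow_mul, mul_comm _ (N : ℤ), zpow_mul, zpow_natCast,
        hvN, one_zpow, mul_one]
    · rw [mul_pow, hvn, mul_div_cancel₀ _ (pow_ne_zero _ hy0)]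

theorem odd_div_gcd_iff {N s k n : ℕ} (hN : N = 2 ^ s * k) (hk : Odd k) :
    Odd (N / n.gcd N) ↔ 2 ^ s ∣ n := by
  have hd : 0 < n.gcd N :=
    Nat.gcd_pos_of_pos_right _ (by rw [hN]; exact Nat.mul_pos (by positivity) hk.pos)
  obtain ⟨M, hM⟩ := Nat.gcd_dvd_right n N
  rw [Nat.div_eq_of_eq_mul_right hd hM]
  constructor
  · intro h
    have h1 : 2 ^ s ∣ n.gcd N * M := hM ▸ ⟨k, hN⟩
    exact ((Nat.Coprime.pow_left s h.coprime_two_left).dvd_of_dvd_mul_right h1).trans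
      (Nat.gcd_dvd_left n N)
  · intro h
    obtain ⟨t, ht⟩ := Nat.dvd_gcd h (show 2 ^ s ∣ N from ⟨k, hN⟩)
    have : t * M = k := by
      apply Nat.eq_of_mul_eq_mul_left (show 0 < 2 ^ s by positivity)
      rw [← hN, ← mul_assoc, ← ht, ← hM]
    exact (Nat.odd_mul.mp (this ▸ hk)).2

theorem range_add_div_iff {F L : Type*} [Field F] [Fintype F] [Field L] [Algebra F L] {a : F}
    {y : L} (hy : y ≠ 0) :
    (∃ x : F, algebraMap F L x = y + algebraMap F L a / y) ↔
      y ^ (Fintype.card F - 1) = 1 ∨ y ^ (Fintype.card F + 1) = algebraMap F L a := by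
  set q := Fintype.card F
  set b := algebraMap F L a
  have hb : b ^ q = b := by rw [← map_pow, FiniteField.pow_card]
  have hfrob : (y + b / y) ^ q = y ^ q + b / y ^ q := by
    have h : (y + b / y) ^ q = y ^ q + (b / y) ^ q :=
      map_add (FiniteField.frobeniusAlgHom F L) y (b / y)
    rw [h, div_pow, hb]
  have hyq : y ^ q ≠ 0 := pow_ne_zero _ hy
  have h1 : y ^ q = y ^ (q - 1) * y := by
    rw [← pow_succ, Nat.sub_add_cancel Fintype.card_pos]
  have key : (y + b / y) ^ q = y + b / y ↔ y ^ (q - 1) = 1 ∨ y ^ (q + 1) = b := by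
    have e1 : y ^ (q - 1) = 1 ↔ y ^ q - y = 0 := by
      rw [h1, sub_eq_zero]
      constructor
      · intro h; rw [h, one_mul]
      · intro h; exact mul_right_cancel₀ hy (by rw [h, one_mul])
    have e2 : y ^ (q + 1) = b ↔ y ^ q * y - b = 0 := by rw [pow_succ, sub_eq_zero]
    rw [e1, e2, ← mul_eq_zero, hfrob]
    constructor
    · intro h
      field_simp at h
      linear_combination h
    · intro h
      field_simp
      linear_combination h
  rw [← key]
  constructor
  · rintro ⟨x, hx⟩
    rw [← hx, ← map_pow, FiniteField.pow_card]
  · exact exists_algebraMap_eq_of_pow_card_eq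

theorem pow_half_pow_div_gcd {R : Type*} [CommRing R] {N n : ℕ} (hN : 0 < N) (hN2 : Even N)
    (hn : Even n) {b c : R} (hb : b ^ (N / 2) = -c) :
    (b ^ (n / 2)) ^ (N / n.gcd N) = (-c) ^ (n / n.gcd N) := by
  have hd : 0 < n.gcd N := Nat.gcd_pos_of_pos_right _ hN
  obtain ⟨k, hk⟩ := Nat.gcd_dvd_left n N
  obtain ⟨M, hM⟩ := Nat.gcd_dvd_right n N
  rw [Nat.div_eq_of_eq_mul_right hd hk, Nat.div_eq_of_eq_mul_right hd hM, ← hb, ← pow_mul,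
    ← pow_mul]
  congr 1
  apply Nat.eq_of_mul_eq_mul_left two_pos
  rw [← mul_assoc, ← mul_assoc, Nat.two_mul_div_two_of_even hn, Nat.two_mul_div_two_of_even hN2]
  conv_lhs => rw [hk]
  conv_rhs => rw [hM]
  ring

theorem sq_div_mem_nthRootsFinset {L : Type*} [Field L] {M m : ℕ} (hM : 0 < M) {c e u : L}
    (hc : c ≠ 0) (he : e ^ M = (-c) ^ m) (hu : u ∈ nthRootsFinset M (c ^ m)) :
    e ^ 2 / u ∈ nthRootsFinset M (c ^ m) := by
  rw [mem_nthRootsFinset hM] at hu ⊢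
  rw [div_pow, hu, ← pow_mul, mul_comm, pow_mul, he, ← pow_mul, mul_comm, pow_mul, neg_sq,
    div_eq_iff (pow_ne_zero _ hc)]
  ring

theorem two_pow_pred_dvd_of_two_mul {r k N : ℕ} (hk : Odd k)
    (hr : 2 ^ r ∣ 2 * k * N ∧ ¬ 2 ^ (r + 1) ∣ 2 * k * N) : ∃ j, N = 2 ^ (r - 1) * j ∧ Odd j := by
  obtain ⟨h1, h2⟩ := hr
  cases r with
  | zero => exact absurd ⟨k * N, by ring⟩ h2
  | succ s =>
    have hs : 2 ^ s ∣ k * N := by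
      rw [pow_succ', mul_assoc] at h1
      exact Nat.dvd_of_mul_dvd_mul_left two_pos h1
    obtain ⟨j, rfl⟩ := (Nat.Coprime.pow_left s hk.coprime_two_left).dvd_of_dvd_mul_left hs
    refine ⟨j, rfl, ?_⟩
    rw [← Nat.not_even_iff_odd]
    rintro hj
    obtain ⟨t, rfl⟩ := hj.two_dvd
    exact h2 ⟨k * t, by ring⟩

/-- One of `q - 1`, `q + 1` is twice an odd number, and the other carries the remaining power
of two. -/
theorem odd_div_gcd_or {q n r : ℕ} (hq : Odd q) (hn : Even n)
    (hr : 2 ^ r ∣ q ^ 2 - 1 ∧ ¬ 2 ^ (r + 1) ∣ q ^ 2 - 1) :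
    (Odd ((q - 1) / n.gcd (q - 1)) ∧
      (Odd ((q + 1) / n.gcd (q + 1)) ↔ 2 ^ (r - 1) ∣ n)) ∨
    (Odd ((q + 1) / n.gcd (q + 1)) ∧
      (Odd ((q - 1) / n.gcd (q - 1)) ↔ 2 ^ (r - 1) ∣ n)) := by
  have hn2 : 2 ^ 1 ∣ n := by simpa using hn.two_dvd
  have hsq : q ^ 2 - 1 = (q + 1) * (q - 1) := by simpa using Nat.sq_sub_sq q 1
  rw [hsq] at hr
  obtain ⟨t, rfl⟩ := hq
  rcases Nat.even_or_odd t with ht | ht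
  · have hk : Odd (t + 1) := ht.add_one
    have e : 2 * t + 1 + 1 = 2 * (t + 1) := by ring
    rw [e] at hr
    obtain ⟨j, hj, hjo⟩ := two_pow_pred_dvd_of_two_mul hk hr
    exact Or.inr ⟨(odd_div_gcd_iff (s := 1) (by rw [e, pow_one]) hk).2 hn2,
      odd_div_gcd_iff hj hjo⟩
  · have e : 2 * t + 1 - 1 = 2 * t := by simp
    rw [mul_comm, e] at hr
    obtain ⟨j, hj, hjo⟩ := two_pow_pred_dvd_of_two_mul ht hr
    exact Or.inl ⟨(odd_div_gcd_iff (s := 1) (by rw [e, pow_one]) ht).2 hn2,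
      odd_div_gcd_iff hj hjo⟩

/-- Combination of the values at the fixed points `± e` in the two families. -/
theorem sum_union_sub_sum_inter_signs {L : Type*} [Field L] [DecidableEq L] {e : L}
    {M m M' m' : ℕ} {P : Prop} [Decidable P] (hm : m.Coprime M) (hm' : m'.Coprime M')
    (h : (Odd M ∧ (Odd M' ↔ P)) ∨ (Odd M' ∧ (Odd M ↔ P))) :
    ∑ u ∈ (if Odd M then {(-1) ^ m * e} else ∅) ∪ (if Odd M' then {(-1) ^ m' * e} else ∅), u
      - ∑ u ∈ (if Odd M then {(-1) ^ m * e} else ∅) ∩ (if Odd M' then {(-1) ^ m' * e} else ∅), u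
      = if P then 0 else -((-1) ^ (m + m') * e) := by
  have hodd : ∀ {m M : ℕ}, m.Coprime M → ¬ Odd M → Odd m := fun {m M} hc hM => by
    rw [Nat.not_odd_iff_even] at hM
    exact (hc.coprime_dvd_right hM.two_dvd).odd_of_right
  by_cases hP : P
  · obtain ⟨h1, h2⟩ : Odd M ∧ Odd M' := by tauto
    rw [if_pos h1, if_pos h2, if_pos hP]
    by_cases hs : (-1) ^ m * e = (-1) ^ m' * e
    · simp [hs]
    · rw [Finset.sum_union (by simpa using hs),
        Finset.inter_singleton_of_notMem (by simpa using Ne.symm hs)]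
      rcases neg_one_pow_eq_or L m with h | h <;> rcases neg_one_pow_eq_or L m' with h' | h' <;>
        simp_all
  · rcases h with ⟨h1, h2⟩ | ⟨h1, h2⟩
    · have h3 : ¬ Odd M' := by tauto
      rw [if_pos h1, if_neg h3, if_neg hP]
      simp [pow_add, (hodd hm' h3).neg_one_pow]
    · have h3 : ¬ Odd M := by tauto
      rw [if_pos h1, if_neg h3, if_neg hP]
      simp [pow_add, (hodd hm h3).neg_one_pow]

/-- The trivial-subgroup contribution, rewritten in terms of `e`. -/
theorem ite_div_gcd_eq_one {L : Type*} [Field L] {N n : ℕ} (hN : 0 < N) {c e : L}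
    (he : e ^ (N / n.gcd N) = (-c) ^ (n / n.gcd N)) :
    (if N / n.gcd N = 1 then c ^ (n / n.gcd N) else 0) =
      if n.gcd N = N then (-1) ^ (n / n.gcd N) * e else 0 := by
  have hiff : N / n.gcd N = 1 ↔ n.gcd N = N := by
    constructor
    · intro h
      simpa [h] using Nat.mul_div_cancel' (Nat.gcd_dvd_right n N)
    · intro h
      rw [h, Nat.div_self hN]
  simp only [hiff]
  split_ifs with h
  · rw [hiff.2 h, pow_one] at he
    rw [he, ← mul_pow, neg_one_mul, neg_neg]
  · rfl

theorem exists_eq_add_div {L : Type*} [Field L] [IsAlgClosed L] (h2 : (2 : L) ≠ 0) (x : L) {b : L}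
    (hb : b ≠ 0) : ∃ y, y ≠ 0 ∧ x = y + b / y := by
  obtain ⟨s, hs⟩ := IsAlgClosed.exists_pow_nat_eq (x ^ 2 - 4 * b) two_pos
  have hy : (x + s) / 2 * (x - (x + s) / 2) = b := by
    field_simp
    linear_combination -hs
  have hy0 : (x + s) / 2 ≠ 0 := fun h => hb (by rw [← hy, h, zero_mul])
  refine ⟨(x + s) / 2, hy0, ?_⟩
  rw [← hy, mul_div_cancel_left₀ _ hy0]
  ring

theorem image_eval_dickson_eq {F L : Type*} [Field F] [Fintype F] [DecidableEq F] [Field L]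
    [DecidableEq L] [Algebra F L] [IsAlgClosed L] (h2 : (2 : L) ≠ 0) {a : F} (ha : a ≠ 0)
    {n : ℕ} {e : L} (he : e ^ 2 = algebraMap F L a ^ n) :
    ((Finset.univ.image fun x : F => (dickson 1 a n).eval x).image (algebraMap F L)) =
      (nthRootsFinset ((Fintype.card F - 1) / n.gcd (Fintype.card F - 1))
          ((1 : L) ^ (n / n.gcd (Fintype.card F - 1))) ∪
        nthRootsFinset ((Fintype.card F + 1) / n.gcd (Fintype.card F + 1))
          (algebraMap F L a ^ (n / n.gcd (Fintype.card F + 1)))).image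
        fun u => u + e ^ 2 / u := by
  have hb : algebraMap F L a ≠ 0 := by simpa using ha
  have hpos : 0 < Fintype.card F - 1 := Nat.sub_pos_of_lt Fintype.one_lt_card
  have hdiv : ∀ {N : ℕ}, 0 < N → 0 < N / n.gcd N := fun hN => Nat.div_pos
    (Nat.le_of_dvd hN (Nat.gcd_dvd_right _ _)) (Nat.gcd_pos_of_pos_right _ hN)
  have heval : ∀ (x : F) (y : L), y ≠ 0 → algebraMap F L x = y + algebraMap F L a / y →
      algebraMap F L ((dickson 1 a n).eval x) = y ^ n + e ^ 2 / y ^ n := by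
    intro x y hy hx
    have := eval_add_dickson_one_mul y (algebraMap F L a / y) n
    rw [mul_div_cancel₀ _ hy, ← hx, ← map_dickson, eval_map_algebraMap, aeval_algebraMap_apply,
      div_pow] at this
    rw [he, ← this]
    rfl
  ext w
  simp only [Finset.mem_image, Finset.mem_univ, true_and, Finset.mem_union, exists_exists_eq_and,
    mem_nthRootsFinset (hdiv hpos), mem_nthRootsFinset (hdiv (Nat.succ_pos (Fintype.card F))),
    ← exists_pow_eq_iff_pow_div_gcd_eq hpos n one_ne_zero,
    ← exists_pow_eq_iff_pow_div_gcd_eq (Nat.succ_pos (Fintype.card F)) n hb]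
  constructor
  · rintro ⟨x, rfl⟩
    obtain ⟨y, hy, hx⟩ := exists_eq_add_div h2 (algebraMap F L x) hb
    refine ⟨y ^ n, ?_, (heval x y hy hx).symm⟩
    rcases (range_add_div_iff hy).1 ⟨x, hx⟩ with h | h
    · exact Or.inl ⟨y, h, rfl⟩
    · exact Or.inr ⟨y, h, rfl⟩
  · have aux : ∀ y : L, y ≠ 0 → (y ^ (Fintype.card F - 1) = 1 ∨
        y ^ (Fintype.card F + 1) = algebraMap F L a) →
        ∃ x, algebraMap F L ((dickson 1 a n).eval x) = y ^ n + e ^ 2 / y ^ n := by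
      intro y hy h
      obtain ⟨x, hx⟩ := (range_add_div_iff hy).2 h
      exact ⟨x, heval x y hy hx⟩
    rintro ⟨_, ⟨y, hy, rfl⟩ | ⟨y, hy, rfl⟩, rfl⟩
    · exact aux y (by rintro rfl; simp [hpos.ne'] at hy) (Or.inl hy)
    · exact aux y (by rintro rfl; exact hb (by rw [← hy]; simp)) (Or.inr hy)

/-- Closed form for the residue sum of `D_n(x,a)` when `a` is a nonsquare. -/
theorem dickson_residue_sum_nonsquare {F : Type*} [Field F] [Fintype F] [DecidableEq F]
    {q : ℕ} (hF : Fintype.card F = q) (hq : Odd q) (hq3 : 3 < q)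
    (a : F) (ha : ¬ IsSquare a) (ha0 : a ≠ 0) (n : ℕ) (hn : Even n)
    (d δ r : ℕ) (hd : d = Nat.gcd n (q - 1)) (hδ : δ = Nat.gcd n (q + 1))
    (hr : 2 ^ r ∣ q ^ 2 - 1 ∧ ¬ 2 ^ (r + 1) ∣ q ^ 2 - 1) :
    ∑ y ∈ Finset.image (fun x : F => Polynomial.eval x (Polynomial.dickson 1 a n))
        Finset.univ, y =
      (if 2 ^ (r - 1) ∣ n then 0
        else -((-1 : F) ^ (n / d + n / δ) * a ^ (n / 2))) +
      (if d = q - 1 then (-1 : F) ^ (n / d) * a ^ (n / 2) else 0) +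
      (if δ = q + 1 then (-1 : F) ^ (n / δ) * a ^ (n / 2) else 0) := by
  classical
  subst hd hδ
  let L := AlgebraicClosure F
  have hinj : Function.Injective (algebraMap F L) := (algebraMap F L).injective
  have hqF : (q : F) = 0 := by rw [← hF, FiniteField.cast_card_eq_zero]
  have hq0 : (q : L) = 0 := by simpa using congrArg (algebraMap F L) hqF
  have hpos : 0 < q - 1 := by omega
  have h2F : (2 : F) ≠ 0 := by
    intro h
    obtain ⟨t, ht⟩ := hq
    rw [ht] at hqF
    push_cast at hqF
    rw [h] at hqF
    simp at hqF
  have h2 : (2 : L) ≠ 0 := by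
    intro h
    exact h2F (hinj (by rw [map_ofNat, map_zero]; exact h))
  have hchar : ringChar F ≠ 2 := fun h => h2F (by
    have := ringChar.Nat.cast_ringChar (R := F)
    rwa [h] at this)
  have hhalf : a ^ (q / 2) = -1 := by
    have h := FiniteField.pow_dichotomy hchar ha0
    rw [FiniteField.isSquare_iff hchar ha0] at ha
    rw [← hF]
    exact h.resolve_left ha
  set b := algebraMap F L a with hb_def
  have hb : b ≠ 0 := by simpa [b] using ha0
  have hbhalf : b ^ (q / 2) = -1 := by rw [hb_def, ← map_pow, hhalf, map_neg, map_one]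
  set e := b ^ (n / 2) with he_def
  have he0 : e ≠ 0 := pow_ne_zero _ hb
  have he2 : e ^ 2 = b ^ n := by rw [he_def, ← pow_mul, Nat.div_two_mul_two_of_even hn]
  have hE1 : e ^ ((q - 1) / n.gcd (q - 1)) = (-1) ^ (n / n.gcd (q - 1)) := by
    refine pow_half_pow_div_gcd hpos (hq.tsub_odd odd_one) hn ?_
    rw [← hbhalf]
    congr 1
    obtain ⟨t, rfl⟩ := hq
    omega
  have hE2 : e ^ ((q + 1) / n.gcd (q + 1)) = (-b) ^ (n / n.gcd (q + 1)) := by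
    refine pow_half_pow_div_gcd q.succ_pos hq.add_one hn ?_
    rw [← neg_one_mul, ← hbhalf, ← pow_succ]
    congr 1
    obtain ⟨t, rfl⟩ := hq
    omega
  have hdiv : ∀ {N : ℕ}, 0 < N → 0 < N / n.gcd N := fun hN => Nat.div_pos
    (Nat.le_of_dvd hN (Nat.gcd_dvd_right _ _)) (Nat.gcd_pos_of_pos_right _ hN)
  have hcast : ∀ {N : ℕ}, (N : L) ≠ 0 → ((N / n.gcd N : ℕ) : L) ≠ 0 := by
    intro N hN h
    apply hN
    rw [← Nat.div_mul_cancel (Nat.gcd_dvd_right n N), Nat.cast_mul, h, zero_mul]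
  have hM1 := hdiv hpos
  have hM2 := hdiv q.succ_pos
  have hM1' : (((q - 1) / n.gcd (q - 1) : ℕ) : L) ≠ 0 :=
    hcast (by rw [Nat.cast_sub (by omega), hq0]; simp)
  have hM2' : (((q + 1) / n.gcd (q + 1) : ℕ) : L) ≠ 0 :=
    hcast (by rw [Nat.cast_add, hq0]; simp)
  have hcop1 : (n / n.gcd (q - 1)).Coprime ((q - 1) / n.gcd (q - 1)) :=
    Nat.coprime_div_gcd_div_gcd (Nat.gcd_pos_of_pos_right _ hpos)
  have hcop2 : (n / n.gcd (q + 1)).Coprime ((q + 1) / n.gcd (q + 1)) :=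
    Nat.coprime_div_gcd_div_gcd (Nat.gcd_pos_of_pos_right _ q.succ_pos)
  have himg := image_eval_dickson_eq (L := L) h2 ha0 he2
  rw [hF] at himg
  set H := nthRootsFinset ((q - 1) / n.gcd (q - 1)) ((1 : L) ^ (n / n.gcd (q - 1))) with hH
  set K := nthRootsFinset ((q + 1) / n.gcd (q + 1)) (b ^ (n / n.gcd (q + 1))) with hK
  have hHf : H.filter (fun u => u ^ 2 = e ^ 2) = _ :=
    filter_sq_eq_nthRootsFinset h2 hM1 hcop1 one_ne_zero hE1
  have hKf : K.filter (fun u => u ^ 2 = e ^ 2) = _ :=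
    filter_sq_eq_nthRootsFinset h2 hM2 hcop2 hb hE2
  have hHsum : ∑ u ∈ H, u = _ :=
    (sum_nthRootsFinset hM1' _).trans (ite_div_gcd_eq_one hpos hE1)
  have hKsum : ∑ u ∈ K, u = _ :=
    (sum_nthRootsFinset hM2' _).trans (ite_div_gcd_eq_one q.succ_pos hE2)
  have hinter : H ∩ K = H.filter (fun u => u ^ 2 = e ^ 2) ∩ K.filter (fun u => u ^ 2 = e ^ 2) := by
    rw [← Finset.filter_inter_distrib, eq_comm, Finset.filter_eq_self]
    intro u hu
    rw [Finset.mem_inter, hH, hK, mem_nthRootsFinset hM1, mem_nthRootsFinset hM2, one_pow] at hu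
    obtain ⟨h1, h2⟩ := hu
    have h1' : u ^ (q - 1) = 1 := by
      rw [← Nat.div_mul_cancel (Nat.gcd_dvd_right n (q - 1)), pow_mul, h1, one_pow]
    have h2' : u ^ (q + 1) = b ^ n := by
      rw [← Nat.div_mul_cancel (Nat.gcd_dvd_right n (q + 1)), pow_mul, h2, ← pow_mul,
        Nat.div_mul_cancel (Nat.gcd_dvd_left n (q + 1))]
    rw [he2, ← h2', show q + 1 = (q - 1) + 2 by omega, pow_add, h1', one_mul]
  have htotal := sum_image_add_sq_div he0 (H ∪ K)
    (fun u hu => (Finset.mem_union.1 hu).elim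
      (ne_zero_of_mem_nthRootsFinset (pow_ne_zero _ one_ne_zero))
      (ne_zero_of_mem_nthRootsFinset (pow_ne_zero _ hb)))
    (fun u hu => Finset.mem_union.2 ((Finset.mem_union.1 hu).imp
      (sq_div_mem_nthRootsFinset hM1 one_ne_zero hE1) (sq_div_mem_nthRootsFinset hM2 hb hE2)))
  have hui := Finset.sum_union_inter (s₁ := H) (s₂ := K) (f := fun u : L => u)
  have hsigns := sum_union_sub_sum_inter_signs (e := e) hcop1 hcop2 (odd_div_gcd_or hq hn hr)
  rw [← hHf, ← hKf, ← hinter, ← Finset.filter_union] at hsigns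
  rw [← himg, Finset.sum_image hinj.injOn, ← map_sum] at htotal
  apply hinj
  rw [htotal]
  simp only [map_add, apply_ite (algebraMap F L), map_mul, map_neg, map_pow, map_one, map_zero,
    ← hb_def, ← he_def]
  rw [← hHsum, ← hKsum, ← hsigns]
  linear_combination hui
end

section
/- Let q be an odd prime power with q > 3, F a finite field with q elements, a ∈ F a nonzero square, and n an even natural number. Suppose x, y ∈ F are such that x² − 4a is a nonzero square in F, y² − 4a is a nonsquare in F, and D_n(x,a) = D_n(y,a). Then D_n(x,a) = 2·a^(n/2). In particular, every common value of D_n(·,a) on the hyperbolic and elliptic sets lies in the image of the parabolic set. -/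
open Polynomial

namespace Polynomial

section CommRing

variable {R : Type*} [CommRing R] (a x : R)

/-- The norm form identity relating consecutive values of the Dickson polynomials. -/
theorem eval_dickson_one_norm_form (n : ℕ) :
    eval x (dickson 1 a (n + 1)) ^ 2
        - x * eval x (dickson 1 a n) * eval x (dickson 1 a (n + 1))
        + a * eval x (dickson 1 a n) ^ 2 = -a ^ n * (x ^ 2 - 4 * a) := by
  induction n with
  | zero => simp; ring
  | succ n ih =>
    simp only [dickson_add_two, eval_sub, eval_mul, eval_X, eval_C]
    linear_combination a * ih

theorem eval_dickson_one_two_mul_and_succ (m : ℕ) :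
    eval x (dickson 1 a (2 * m)) = eval x (dickson 1 a m) ^ 2 - 2 * a ^ m ∧
      eval x (dickson 1 a (2 * m + 1)) =
        eval x (dickson 1 a m) * eval x (dickson 1 a (m + 1)) - a ^ m * x := by
  induction m with
  | zero => constructor <;> simp <;> ring
  | succ m ih =>
    obtain ⟨h₀, h₁⟩ := ih
    have h₂ : eval x (dickson 1 a (2 * (m + 1))) =
        eval x (dickson 1 a (m + 1)) ^ 2 - 2 * a ^ (m + 1) := by
      rw [mul_add_one, dickson_add_two]
      simp only [eval_sub, eval_mul, eval_X, eval_C]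
      linear_combination x * h₁ - a * h₀ - eval_dickson_one_norm_form a x m
    refine ⟨h₂, ?_⟩
    rw [show 2 * (m + 1) + 1 = 2 * m + 1 + 2 by ring, dickson_add_two _ _ (2 * m + 1),
      dickson_add_two _ _ m, show 2 * m + 1 + 1 = 2 * (m + 1) by ring]
    simp only [eval_sub, eval_mul, eval_X, eval_C]
    linear_combination x * h₂ - a * h₁

theorem eval_dickson_one_two_mul (m : ℕ) :
    eval x (dickson 1 a (2 * m)) = eval x (dickson 1 a m) ^ 2 - 2 * a ^ m :=
  (eval_dickson_one_two_mul_and_succ a x m).1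

theorem isSquare_discrim_mul_eval_dickson_one (n : ℕ) :
    IsSquare ((x ^ 2 - 4 * a) * (eval x (dickson 1 a n) ^ 2 - 4 * a ^ n)) :=
  ⟨2 * eval x (dickson 1 a (n + 1)) - x * eval x (dickson 1 a n), by
    linear_combination -4 * eval_dickson_one_norm_form a x n⟩

end CommRing

/-- A common value `d` of `D_n(·,a)` on a hyperbolic and an elliptic element satisfies
`d ^ 2 = 4 a ^ n`. -/
theorem eval_dickson_one_sq_of_eq {K : Type*} [Field K] {a x y : K} {n : ℕ}
    (hx₀ : x ^ 2 - 4 * a ≠ 0) (hx : IsSquare (x ^ 2 - 4 * a))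
    (hy : ¬ IsSquare (y ^ 2 - 4 * a))
    (heq : eval x (dickson 1 a n) = eval y (dickson 1 a n)) :
    eval x (dickson 1 a n) ^ 2 = 4 * a ^ n := by
  by_contra hne
  have ht := sub_ne_zero.mpr hne
  have hxt := (isSquare_discrim_mul_eval_dickson_one a x n).div hx
  have hyt := isSquare_discrim_mul_eval_dickson_one a y n
  rw [mul_div_cancel_left₀ _ hx₀] at hxt
  rw [← heq] at hyt
  have := hyt.div hxt
  rw [mul_div_cancel_right₀ _ ht] at this
  exact hy this

end Polynomial

/-- For `a` a nonzero square, any common value of `D_n(·,a)` on a hyperbolic and an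
elliptic element equals `2 a^(n/2)` (hence lies in the parabolic image). -/
theorem residue_hyperbolic_elliptic_overlap {F : Type*} [Field F] [Fintype F]
    {q : ℕ} (hF : Fintype.card F = q) (hq : Odd q) (hq3 : 3 < q)
    (a : F) (ha : IsSquare a) (ha0 : a ≠ 0) (n : ℕ) (hn : Even n) (x y : F)
    (hx : x ^ 2 - 4 * a ≠ 0 ∧ IsSquare (x ^ 2 - 4 * a))
    (hy : ¬ IsSquare (y ^ 2 - 4 * a))
    (heq : Polynomial.eval x (Polynomial.dickson 1 a n) =
      Polynomial.eval y (Polynomial.dickson 1 a n)) :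
    Polynomial.eval x (Polynomial.dickson 1 a n) = 2 * a ^ (n / 2) := by
  obtain ⟨m, rfl⟩ := hn.two_dvd
  have h2 : (2 : F) ≠ 0 := Ring.two_ne_zero fun h => by
    have := FiniteField.even_card_iff_char_two.mp h
    rw [hF] at this
    exact Nat.not_even_iff_odd.mpr hq (Nat.even_iff.mpr this)
  have hsq := eval_dickson_one_sq_of_eq hx.1 hx.2 hy heq
  rw [Nat.mul_div_cancel_left m two_pos]
  have hprod : (eval x (dickson 1 a (2 * m)) - 2 * a ^ m) *
      (eval x (dickson 1 a (2 * m)) + 2 * a ^ m) = 0 := by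
    rw [pow_mul'] at hsq
    linear_combination hsq
  refine (mul_eq_zero.mp hprod).elim sub_eq_zero.mp fun hneg => ?_
  have hx0 : eval x (dickson 1 a m) = 0 := by
    rw [eval_dickson_one_two_mul] at hneg
    exact pow_eq_zero_iff two_ne_zero |>.mp (by linear_combination hneg)
  have hy0 : eval y (dickson 1 a m) = 0 := by
    rw [heq, eval_dickson_one_two_mul] at hneg
    exact pow_eq_zero_iff two_ne_zero |>.mp (by linear_combination hneg)
  have h := eval_dickson_one_sq_of_eq hx.1 hx.2 hy (hx0.trans hy0.symm)
  rw [hx0] at h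
  refine absurd ?_ (mul_ne_zero (mul_ne_zero h2 h2) (pow_ne_zero m ha0))
  linear_combination -h
end

section
/- Let q be an odd prime power with q > 3, F a finite field with q elements, a ∈ F a nonzero square, and n an even natural number. Set d = gcd(n, q−1) and δ = gcd(n, q+1). Then: (1) 2·a^(n/2) belongs to the image of the hyperbolic set H_q(a) under D_n(·,a) if and only if d ≠ 2; and (2) 2·a^(n/2) belongs to the image of the elliptic set E_q(a) under D_n(·,a) if and only if δ ≠ 2. -/
open Polynomial

theorem Polynomial.eval_dickson_one_add {R : Type*} [CommRing R] (x y : R) :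
    ∀ n : ℕ, (dickson 1 (x * y) n).eval (x + y) = x ^ n + y ^ n
  | 0 => by simp only [pow_zero, dickson_zero]; norm_num
  | 1 => by simp only [eval_X, dickson_one, pow_one]
  | n + 2 => by
    simp only [eval_sub, eval_mul, eval_dickson_one_add x y _, eval_X, dickson_add_two, eval_C]
    ring

theorem FiniteField.mem_range_algebraMap_of_pow_card_eq (F : Type*) {K : Type*} [Field F]
    [Fintype F] [Field K] [Algebra F K] {u : K} (hu : u ^ Fintype.card F = u) :
    ∃ c : F, algebraMap F K c = u := by
  have hmem : u ∈ ((X ^ Fintype.card F - X : F[X]).map (algebraMap F K)).roots := by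
    have hne := FiniteField.X_pow_card_sub_X_ne_zero F (Fintype.one_lt_card (α := F))
    rw [mem_roots (Polynomial.map_ne_zero hne)]
    simp [hu]
  have hs : (X ^ Fintype.card F - X : F[X]).Splits := by
    rw [splits_iff_card_roots, FiniteField.roots_X_pow_card_sub_X,
      FiniteField.X_pow_card_sub_X_natDegree_eq F (Fintype.one_lt_card (α := F))]
    rfl
  rw [hs.roots_map, Multiset.mem_map] at hmem
  exact hmem.imp fun _ h => h.2

theorem FiniteField.pow_card_sub_one_eq_one_iff {F K : Type*} [Field F] [Fintype F] [Field K]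
    {u : K} (hu : u ≠ 0) :
    u ^ (Fintype.card F - 1) = 1 ↔ u ^ Fintype.card F = u := by
  conv_rhs => rw [← Nat.sub_add_cancel (Fintype.card_pos (α := F)), pow_succ]
  exact (mul_eq_right₀ hu).symm

section QuadraticParametrization

variable {F K : Type*} [Field F] [Field K] [Algebra F K]

theorem FiniteField.add_inv_pow_card [Fintype F] (u : K) :
    (u + u⁻¹) ^ Fintype.card F = u ^ Fintype.card F + (u ^ Fintype.card F)⁻¹ := by
  have h := map_add (FiniteField.frobeniusAlgHom F K) u u⁻¹
  simpa [FiniteField.coe_frobeniusAlgHom] using h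

theorem FiniteField.add_inv_mem_range_iff [Fintype F] {u : K} (hu : u ≠ 0) :
    (∃ c : F, algebraMap F K c = u + u⁻¹) ↔
      u ^ (Fintype.card F - 1) = 1 ∨ u ^ (Fintype.card F + 1) = 1 := by
  rw [pow_card_sub_one_eq_one_iff hu, pow_succ]
  have huq : u ^ Fintype.card F ≠ 0 := pow_ne_zero _ hu
  constructor
  · rintro ⟨c, hc⟩
    have h := add_inv_pow_card (F := F) u
    rw [← hc, ← map_pow, FiniteField.pow_card, hc] at h
    have h' : (u ^ Fintype.card F - u) * (u ^ Fintype.card F * u - 1) = 0 := by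
      field_simp at h
      linear_combination -h
    exact (mul_eq_zero.1 h').imp sub_eq_zero.1 sub_eq_zero.1
  · intro h
    apply mem_range_algebraMap_of_pow_card_eq
    rw [add_inv_pow_card]
    rcases h with h | h
    · rw [h]
    · rw [eq_inv_of_mul_eq_one_left h, inv_inv, add_comm]

variable {b c : F} {u : K}

theorem sq_sub_four_mul_eq_of_eq_mul_add_inv (hu : u ≠ 0)
    (hc : algebraMap F K c = algebraMap F K b * (u + u⁻¹)) :
    algebraMap F K (c ^ 2 - 4 * (b * b)) = (algebraMap F K b * (u - u⁻¹)) ^ 2 := by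
  simp only [map_sub, map_pow, map_mul, map_ofNat, hc]
  field_simp
  ring

theorem sq_sub_four_mul_eq_zero_iff (hb : b ≠ 0) (hu : u ≠ 0)
    (hc : algebraMap F K c = algebraMap F K b * (u + u⁻¹)) :
    c ^ 2 - 4 * (b * b) = 0 ↔ u ^ 2 = 1 := by
  rw [← map_eq_zero (algebraMap F K), sq_sub_four_mul_eq_of_eq_mul_add_inv hu hc, sq_eq_zero_iff,
    mul_eq_zero, map_eq_zero, or_iff_right hb, sub_eq_zero,
    ← mul_eq_one_iff_eq_inv₀ hu, sq]

theorem FiniteField.isSquare_sq_sub_four_mul_iff [Fintype F] (h2 : (2 : F) ≠ 0) (hb : b ≠ 0)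
    (hu : u ≠ 0)
    (hc : algebraMap F K c = algebraMap F K b * (u + u⁻¹)) :
    IsSquare (c ^ 2 - 4 * (b * b)) ↔ u ^ (Fintype.card F - 1) = 1 := by
  have hsq := sq_sub_four_mul_eq_of_eq_mul_add_inv hu hc
  have h2K : (2 : K) ≠ 0 := by
    rw [← map_ofNat (algebraMap F K) 2]
    exact (_root_.map_ne_zero _).2 h2
  have hbK : algebraMap F K b ≠ 0 := (_root_.map_ne_zero _).2 hb
  rw [pow_card_sub_one_eq_one_iff hu]
  constructor
  · rintro ⟨s, hs⟩
    rw [hs, map_mul, ← sq, sq_eq_sq_iff_eq_or_eq_neg] at hsq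
    have hex : ∃ t : F, algebraMap F K t = u := by
      rcases hsq with h | h
      · refine ⟨(c + s) / (2 * b), ?_⟩
        simp only [map_div₀, map_add, map_mul, map_ofNat, hc, h]
        field_simp
        ring
      · refine ⟨(c - s) / (2 * b), ?_⟩
        simp only [map_div₀, map_sub, map_mul, map_ofNat, hc, h]
        field_simp
        ring
    obtain ⟨t, rfl⟩ := hex
    rw [← map_pow, FiniteField.pow_card]
  · intro h
    obtain ⟨t, rfl⟩ := mem_range_algebraMap_of_pow_card_eq F h
    refine ⟨b * (t - t⁻¹), (algebraMap F K).injective ?_⟩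
    rw [hsq]
    simp [sq]

theorem eval_dickson_eq_two_mul_pow_iff (hb : b ≠ 0) (hu : u ≠ 0)
    (hc : algebraMap F K c = algebraMap F K b * (u + u⁻¹)) (n : ℕ) :
    (dickson 1 (b * b) n).eval c = 2 * b ^ n ↔ u ^ n = 1 := by
  have hbK : algebraMap F K b ^ n ≠ 0 := pow_ne_zero _ ((_root_.map_ne_zero _).2 hb)
  have hun : u ^ n ≠ 0 := pow_ne_zero _ hu
  have hmap : algebraMap F K ((dickson 1 (b * b) n).eval c) =
      algebraMap F K b ^ n * (u ^ n + (u ^ n)⁻¹) := by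
    rw [← eval_map_apply, map_dickson, hc, map_mul, mul_add, ← inv_pow, mul_add, ← mul_pow,
      ← mul_pow, ← eval_dickson_one_add, mul_mul_mul_comm, mul_inv_cancel₀ hu, mul_one]
  rw [← (algebraMap F K).injective.eq_iff, hmap, map_mul, map_pow, map_ofNat, mul_comm 2,
    mul_right_inj' hbK]
  constructor
  · intro h
    field_simp at h
    have h' : (u ^ n - 1) ^ 2 = 0 := by linear_combination h
    exact sub_eq_zero.1 (pow_eq_zero_iff two_ne_zero |>.1 h')
  · intro h
    rw [h]
    norm_num

theorem exists_eq_mul_add_inv [IsAlgClosed K] (h2 : (2 : F) ≠ 0) (hb : b ≠ 0) (c : F) :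
    ∃ u : K, u ≠ 0 ∧ algebraMap F K c = algebraMap F K b * (u + u⁻¹) := by
  have h2K : (2 : K) ≠ 0 := by
    rw [← map_ofNat (algebraMap F K) 2]
    exact (_root_.map_ne_zero _).2 h2
  have hbK : algebraMap F K b ≠ 0 := (_root_.map_ne_zero _).2 hb
  obtain ⟨s, hs⟩ := IsAlgClosed.exists_pow_nat_eq
    (algebraMap F K c ^ 2 - 4 * algebraMap F K b ^ 2) two_pos
  have hprod : (algebraMap F K c + s) / (2 * algebraMap F K b) *
      ((algebraMap F K c - s) / (2 * algebraMap F K b)) = 1 := by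
    field_simp
    linear_combination -hs
  refine ⟨_, left_ne_zero_of_mul_eq_one hprod, ?_⟩
  rw [← eq_inv_of_mul_eq_one_right hprod]
  field_simp
  ring

end QuadraticParametrization

theorem exists_pow_eq_one_and_sq_ne_one_iff (K : Type*) [Field K] [IsAlgClosed K] {n m : ℕ}
    (hn : Even n) (hm : Even m) (hmK : (m : K) ≠ 0) :
    (∃ u : K, u ^ n = 1 ∧ u ^ m = 1 ∧ u ^ 2 ≠ 1) ↔ n.gcd m ≠ 2 := by
  constructor
  · rintro ⟨u, hun, hum, hu2⟩ h
    exact hu2 (h ▸ pow_gcd_eq_one.2 ⟨hun, hum⟩)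
  · intro h
    have : NeZero ((n.gcd m : ℕ) : K) := ⟨fun h0 => hmK <| by
      obtain ⟨k, hk⟩ := Nat.gcd_dvd_right n m
      rw [hk, Nat.cast_mul, h0, zero_mul]⟩
    obtain ⟨u, hu⟩ := HasEnoughRootsOfUnity.exists_primitiveRoot K (n.gcd m)
    have hun := pow_gcd_eq_one.1 hu.pow_eq_one
    refine ⟨u, hun.1, hun.2, fun hu2 => h ?_⟩
    exact Nat.dvd_antisymm (hu.dvd_of_pow_eq_one 2 hu2)
      (Nat.dvd_gcd hn.two_dvd hm.two_dvd)

theorem two_mul_pow_mem_image_dickson_iff {F : Type*} (K : Type*) [Field F] [Fintype F] [Field K]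
    [Algebra F K] [IsAlgClosed K] (h2 : (2 : F) ≠ 0) {b : F} (hb : b ≠ 0) {n m : ℕ}
    (hn : Even n) (hm : Even m) (hmK : (m : K) ≠ 0)
    (hmF : m = Fintype.card F - 1 ∨ m = Fintype.card F + 1) {S : Set F}
    (hS : ∀ (c : F) (u : K), u ≠ 0 → algebraMap F K c = algebraMap F K b * (u + u⁻¹) →
      (c ∈ S ↔ u ^ m = 1 ∧ u ^ 2 ≠ 1)) :
    2 * b ^ n ∈ (fun x : F => (dickson 1 (b * b) n).eval x) '' S ↔ n.gcd m ≠ 2 := by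
  rw [← exists_pow_eq_one_and_sq_ne_one_iff K hn hm hmK]
  constructor
  · rintro ⟨c, hcS, hcn⟩
    obtain ⟨u, hu, hc⟩ := exists_eq_mul_add_inv (K := K) h2 hb c
    exact ⟨u, (eval_dickson_eq_two_mul_pow_iff hb hu hc n).1 hcn, (hS c u hu hc).1 hcS⟩
  · rintro ⟨u, hun, hum⟩
    have hu : u ≠ 0 := by
      rintro rfl
      have hm0 : m ≠ 0 := by rintro rfl; exact hmK Nat.cast_zero
      exact zero_ne_one ((zero_pow hm0).symm.trans hum.1)
    obtain ⟨c, hc⟩ := (FiniteField.add_inv_mem_range_iff (F := F) hu).2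
      (by rcases hmF with rfl | rfl <;> simp [hum.1])
    have hbc : algebraMap F K (b * c) = algebraMap F K b * (u + u⁻¹) := by rw [map_mul, hc]
    exact ⟨b * c, (hS _ u hu hbc).2 hum, (eval_dickson_eq_two_mul_pow_iff hb hu hbc n).2 hun⟩

/-- For `a` a nonzero square, `2 a^(n/2)` lies in the hyperbolic image iff `d ≠ 2`,
and in the elliptic image iff `δ ≠ 2`. -/
theorem parabolic_value_in_images {F : Type*} [Field F] [Fintype F]
    {q : ℕ} (hF : Fintype.card F = q) (hq : Odd q) (hq3 : 3 < q)
    (a : F) (ha : IsSquare a) (ha0 : a ≠ 0) (n : ℕ) (hn : Even n)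
    (d δ : ℕ) (hd : d = Nat.gcd n (q - 1)) (hδ : δ = Nat.gcd n (q + 1)) :
    (2 * a ^ (n / 2) ∈ (fun x : F => Polynomial.eval x (Polynomial.dickson 1 a n)) ''
        {x : F | x ^ 2 - 4 * a ≠ 0 ∧ IsSquare (x ^ 2 - 4 * a)} ↔ d ≠ 2) ∧
    (2 * a ^ (n / 2) ∈ (fun x : F => Polynomial.eval x (Polynomial.dickson 1 a n)) ''
        {x : F | ¬ IsSquare (x ^ 2 - 4 * a)} ↔ δ ≠ 2) := by
  subst hF hd hδ
  obtain ⟨b, rfl⟩ := ha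
  have hb : b ≠ 0 := left_ne_zero_of_mul ha0
  have h2 : (2 : F) ≠ 0 := Ring.two_ne_zero fun h =>
    (Nat.not_even_iff_odd.2 hq) (FiniteField.even_card_iff_char_two.1 h |> Nat.even_iff.2)
  have hpow : (b * b) ^ (n / 2) = b ^ n := by
    rw [← sq, ← pow_mul, Nat.two_mul_div_two_of_even hn]
  let K := AlgebraicClosure F
  have hcard : ((Fintype.card F : ℕ) : K) = 0 := by
    rw [← map_natCast (algebraMap F K), FiniteField.cast_card_eq_zero, map_zero]
  have hsub : Even (Fintype.card F - 1) := Nat.Odd.sub_odd hq odd_one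
  have hK1 : ((Fintype.card F - 1 : ℕ) : K) ≠ 0 := by
    rw [Nat.cast_sub Fintype.card_pos, hcard]
    simp
  have hK2 : ((Fintype.card F + 1 : ℕ) : K) ≠ 0 := by
    rw [Nat.cast_add, hcard]
    simp
  rw [hpow]
  constructor
  · refine two_mul_pow_mem_image_dickson_iff K h2 hb hn hsub hK1 (.inl rfl) fun c u hu hc => ?_
    rw [Set.mem_ofPred_eq, FiniteField.isSquare_sq_sub_four_mul_iff h2 hb hu hc, ne_eq,
      sq_sub_four_mul_eq_zero_iff hb hu hc, and_comm]
  · refine two_mul_pow_mem_image_dickson_iff K h2 hb hn hq.add_one hK2 (.inr rfl)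
      fun c u hu hc => ?_
    have hrange := (FiniteField.add_inv_mem_range_iff (F := F) hu).1
      ⟨c / b, by rw [map_div₀, hc, mul_div_cancel_left₀ _ ((_root_.map_ne_zero _).2 hb)]⟩
    rw [Set.mem_ofPred_eq, FiniteField.isSquare_sq_sub_four_mul_iff h2 hb hu hc]
    constructor
    · intro h
      refine ⟨hrange.resolve_left h, fun hu2 => h ?_⟩
      obtain ⟨k, hk⟩ := hsub.two_dvd
      rw [hk, pow_mul, hu2, one_pow]
    · rintro ⟨h, hu2⟩ h1
      refine hu2 ?_
      rw [FiniteField.pow_card_sub_one_eq_one_iff hu] at h1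
      rwa [pow_succ, h1, ← sq] at h
end

section
/- Let q be an odd prime power with q > 3, F a finite field with q elements, a ∈ F a nonzero square, and n an even natural number. Set d = gcd(n, q−1), δ = gcd(n, q+1), and let r be the 2-adic valuation of q²−1. Then the residue sum S_q(D_n(x,a)) equals T₁ + T₂ + T₃, where T₁ = 0 if 2^(r−1) divides n and T₁ = −a^(n/2) otherwise; T₂ = a^(n/2) if δ = q+1 and T₂ = 0 otherwise; and T₃ = a^(n/2) if d = q−1 and T₃ = 0 otherwise. -/
open Polynomial

namespace DicksonResidueSum

/-- In a finite set closed under inversion, the sum of the distinct values of `v + v⁻¹`. -/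
theorem sum_image_add_inv {E : Type*} [Field E] [DecidableEq E] (W : Finset E)
    (h0 : (0 : E) ∉ W) (hinv : ∀ v ∈ W, v⁻¹ ∈ W) :
    ∑ y ∈ W.image (fun v => v + v⁻¹), y = ∑ v ∈ W, v + ∑ v ∈ W with v * v = 1, v := by
  rw [Finset.sum_filter, ← Finset.sum_add_distrib,
    ← Finset.sum_fiberwise_of_maps_to (g := fun v : E => v + v⁻¹)
      (t := W.image (fun v => v + v⁻¹)) (fun i hi => Finset.mem_image_of_mem _ hi)]
  refine Finset.sum_congr rfl fun y hy => ?_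
  obtain ⟨v, hv, rfl⟩ := Finset.mem_image.1 hy
  have hv0 : v ≠ 0 := fun h => h0 (h ▸ hv)
  have hfib : ({i ∈ W | i + i⁻¹ = v + v⁻¹} : Finset E) = {v, v⁻¹} := by
    ext i
    simp only [Finset.mem_filter, Finset.mem_insert, Finset.mem_singleton]
    constructor
    · rintro ⟨hi, h⟩
      have hi0 : i ≠ 0 := fun h => h0 (h ▸ hi)
      have : (i - v) * (i - v⁻¹) = 0 := by
        have h' : i * (i + i⁻¹) = i * (v + v⁻¹) := by rw [h]
        rw [mul_add, mul_inv_cancel₀ hi0] at h'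
        linear_combination h' + mul_inv_cancel₀ hv0
      rcases mul_eq_zero.1 this with h | h
      · exact Or.inl (sub_eq_zero.1 h)
      · exact Or.inr (sub_eq_zero.1 h)
    · rintro (rfl | rfl)
      · exact ⟨hv, rfl⟩
      · exact ⟨hinv _ hv, by rw [inv_inv, add_comm]⟩
  rw [hfib]
  by_cases h1 : v * v = 1
  · have : v⁻¹ = v := inv_eq_of_mul_eq_one_left h1
    simp [this, h1]
  · have hne : v ≠ v⁻¹ := fun h => h1 (by nth_rw 2 [h]; exact mul_inv_cancel₀ hv0)
    have h2 : v⁻¹ * v⁻¹ ≠ 1 := fun h => h1 (by rwa [← mul_inv, inv_eq_one] at h)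
    rw [Finset.sum_pair hne]
    simp [h1, h2]

theorem sum_nthRootsFinset_one {E : Type*} [Field E] [IsAlgClosed E] {A : ℕ}
    (hA : (A : E) ≠ 0) :
    ∑ v ∈ nthRootsFinset A (1 : E), v = if A = 1 then 1 else 0 := by
  have hpos : 0 < A := Nat.pos_of_ne_zero (by rintro rfl; simp at hA)
  split_ifs with h
  · subst h
    rw [show nthRootsFinset 1 (1 : E) = {1} by ext v; simp [mem_nthRootsFinset one_pos],
      Finset.sum_singleton]
  · have : NeZero (A : E) := ⟨hA⟩
    obtain ⟨ζ, hζ⟩ := HasEnoughRootsOfUnity.exists_primitiveRoot E A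
    have hζ1 : ζ ≠ 1 := hζ.ne_one (by omega)
    have hζ0 : ζ ≠ 0 := hζ.ne_zero hpos.ne'
    have key : ∑ v ∈ nthRootsFinset A (1 : E), ζ * v = ∑ v ∈ nthRootsFinset A (1 : E), v := by
      refine Finset.sum_bij' (fun v _ => ζ * v) (fun v _ => ζ⁻¹ * v) ?_ ?_ ?_ ?_ ?_ <;>
        simp +contextual [mem_nthRootsFinset hpos, mul_pow, hζ.pow_eq_one, hζ0]
    rw [← Finset.mul_sum] at key
    have : (ζ - 1) * ∑ v ∈ nthRootsFinset A (1 : E), v = 0 := by linear_combination key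
    exact (mul_eq_zero.1 this).resolve_left (sub_ne_zero.2 hζ1)

theorem sum_image_nthRootsFinset_union {E : Type*} [Field E] [IsAlgClosed E] [DecidableEq E]
    {A B : ℕ} (hA : (A : E) ≠ 0) (hB : (B : E) ≠ 0) (h2 : (2 : E) ≠ 0) (hAB : Nat.Coprime A B) :
    ∑ y ∈ (nthRootsFinset A (1 : E) ∪ nthRootsFinset B 1).image (fun v => v + v⁻¹), y =
      (if Odd A ∧ Odd B then 0 else -1) + (if B = 1 then 1 else 0) + (if A = 1 then 1 else 0) := by
  have hApos : 0 < A := Nat.pos_of_ne_zero (by rintro rfl; simp at hA)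
  have hBpos : 0 < B := Nat.pos_of_ne_zero (by rintro rfl; simp at hB)
  have hmem (v : E) : v ∈ nthRootsFinset A (1 : E) ∪ nthRootsFinset B 1 ↔
      v ^ A = 1 ∨ v ^ B = 1 := by
    rw [Finset.mem_union, mem_nthRootsFinset hApos, mem_nthRootsFinset hBpos]
  have hinter : nthRootsFinset A (1 : E) ∩ nthRootsFinset B 1 = {1} := by
    ext v
    rw [Finset.mem_inter, mem_nthRootsFinset hApos, mem_nthRootsFinset hBpos,
      Finset.mem_singleton]
    constructor
    · rintro ⟨ha, hb⟩
      have := Nat.dvd_gcd (orderOf_dvd_of_pow_eq_one ha) (orderOf_dvd_of_pow_eq_one hb)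
      rw [hAB] at this
      exact orderOf_eq_one_iff.1 (Nat.dvd_one.1 this)
    · rintro rfl; simp
  have hsum := Finset.sum_union_inter (s₁ := nthRootsFinset A (1 : E))
    (s₂ := nthRootsFinset B (1 : E)) (f := fun v => v)
  rw [hinter, Finset.sum_singleton, sum_nthRootsFinset_one hA, sum_nthRootsFinset_one hB] at hsum
  have hne : (1 : E) ≠ -1 := fun h => h2 (by linear_combination h)
  have hneg (m : ℕ) : (-1 : E) ^ m = 1 ↔ ¬ Odd m := by
    rcases Nat.even_or_odd m with h | h
    · simp [h.neg_one_pow, h]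
    · simp [h.neg_one_pow, h, hne.symm]
  have hfix : ∑ v ∈ nthRootsFinset A (1 : E) ∪ nthRootsFinset B 1 with v * v = 1, v =
      1 + (if Odd A ∧ Odd B then 0 else -1) := by
    split_ifs with h
    · have : ({v ∈ nthRootsFinset A (1 : E) ∪ nthRootsFinset B 1 | v * v = 1} : Finset E)
          = {1} := by
        ext v
        rw [Finset.mem_filter, hmem, mul_self_eq_one_iff, Finset.mem_singleton]
        constructor
        · rintro ⟨h1, rfl | rfl⟩
          · rfl
          · rw [hneg, hneg] at h1; tauto
        · rintro rfl; simp
      simp [this]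
    · have : ({v ∈ nthRootsFinset A (1 : E) ∪ nthRootsFinset B 1 | v * v = 1} : Finset E)
          = {1, -1} := by
        ext v
        rw [Finset.mem_filter, hmem, mul_self_eq_one_iff, Finset.mem_insert, Finset.mem_singleton]
        constructor
        · exact fun h => h.2
        · rintro (rfl | rfl)
          · simp
          · rw [hneg, hneg]; tauto
      rw [this, Finset.sum_pair hne]
  rw [sum_image_add_inv, hfix]
  · linear_combination hsum
  · rw [hmem]; simp [hApos.ne', hBpos.ne']
  · intro v hv
    rw [hmem] at hv ⊢
    simpa using hv

/-- The `n`-th powers of the `N`-th roots of unity are the `N / gcd n N`-th roots of unity. -/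
theorem exists_pow_eq_and_pow_eq_one_iff {E : Type*} [Field E] [IsAlgClosed E] {n N : ℕ}
    (hN : 0 < N) (v : E) :
    (∃ u : E, u ^ N = 1 ∧ u ^ n = v) ↔ v ^ (N / n.gcd N) = 1 := by
  have hd : 0 < n.gcd N := Nat.gcd_pos_of_pos_right n hN
  constructor
  · rintro ⟨u, hu, rfl⟩
    obtain ⟨k, hk⟩ := Nat.gcd_dvd_left n N
    have : n * (N / n.gcd N) = N * k := by
      nth_rw 1 [hk]
      rw [mul_right_comm, Nat.mul_div_cancel' (Nat.gcd_dvd_right n N)]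
    rw [← pow_mul, this, pow_mul, hu, one_pow]
  · intro hv
    obtain ⟨u, hu⟩ := IsAlgClosed.exists_pow_nat_eq v hd
    have huN : u ^ N = 1 := by
      rw [← Nat.mul_div_cancel' (Nat.gcd_dvd_right n N), pow_mul, hu, hv]
    have hu0 : u ≠ 0 := by rintro rfl; simp [hN.ne'] at huN
    refine ⟨u ^ n.gcdA N, ?_, ?_⟩
    · rw [← zpow_natCast, ← zpow_mul, mul_comm, zpow_mul, zpow_natCast, huN, one_zpow]
    · have := Nat.gcd_eq_gcd_ab n N
      rw [← hu, ← zpow_natCast u (n.gcd N), this, zpow_add₀ hu0, zpow_mul u (N : ℤ), zpow_natCast,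
        huN, one_zpow, mul_one, mul_comm, zpow_mul, zpow_natCast]

theorem mem_range_algebraMap_iff_pow_card {F E : Type*} [Field F] [Fintype F] [Field E]
    [Algebra F E] (x : E) :
    (∃ y : F, algebraMap F E y = x) ↔ x ^ Fintype.card F = x := by
  classical
  constructor
  · rintro ⟨y, rfl⟩
    rw [← map_pow, FiniteField.pow_card]
  · intro hx
    have h1 : 1 < Fintype.card F := Fintype.one_lt_card
    have hne := FiniteField.X_pow_card_sub_X_ne_zero E h1
    have heq : Finset.univ.image (algebraMap F E) =
        (X ^ Fintype.card F - X : E[X]).roots.toFinset := by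
      refine Finset.eq_of_subset_of_card_le ?_ ?_
      · intro z hz
        obtain ⟨y, -, rfl⟩ := Finset.mem_image.1 hz
        rw [Multiset.mem_toFinset, mem_roots hne]
        simp [← map_pow, FiniteField.pow_card]
      · rw [Finset.card_image_of_injective _ (algebraMap F E).injective, Finset.card_univ]
        calc _ ≤ _ := Multiset.toFinset_card_le _
          _ ≤ _ := card_roots' _
          _ = _ := FiniteField.X_pow_card_sub_X_natDegree_eq E h1
    have : x ∈ Finset.univ.image (algebraMap F E) := by
      rw [heq, Multiset.mem_toFinset, mem_roots hne]
      simp [hx]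
    obtain ⟨y, -, hy⟩ := Finset.mem_image.1 this
    exact ⟨y, hy⟩

theorem add_inv_mem_range_iff {F E : Type*} [Field F] [Fintype F] [Field E]
    [Algebra F E] {u : E} (hu : u ≠ 0) :
    (∃ x : F, algebraMap F E x = u + u⁻¹) ↔
      u ^ (Fintype.card F - 1) = 1 ∨ u ^ (Fintype.card F + 1) = 1 := by
  have h1 : 1 < Fintype.card F := Fintype.one_lt_card
  have hadd := map_add (FiniteField.frobeniusAlgHom F E) u u⁻¹
  simp only [FiniteField.frobeniusAlgHom_apply] at hadd
  rw [mem_range_algebraMap_iff_pow_card, hadd, inv_pow]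
  have hsub : u ^ Fintype.card F = u ^ (Fintype.card F - 1) * u := by
    rw [← pow_succ, Nat.sub_add_cancel h1.le]
  have hU : u ^ Fintype.card F ≠ 0 := pow_ne_zero _ hu
  rw [pow_succ]
  have e1 : u ^ (Fintype.card F - 1) = 1 ↔ u ^ Fintype.card F = u := by
    rw [hsub]; simp [hu]
  rw [e1]
  generalize u ^ Fintype.card F = U at hU
  rw [← sub_eq_zero (a := U), ← sub_eq_zero (a := U * u), ← mul_eq_zero, ← sub_eq_zero]
  have : U + U⁻¹ - (u + u⁻¹) = (U - u) * (U * u - 1) * (U⁻¹ * u⁻¹) := by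
    field_simp
    ring
  rw [this]
  simp [hu, hU]

theorem image_dickson_one {F E : Type*} [Field F] [Fintype F] [DecidableEq F] [Field E]
    [IsAlgClosed E] [DecidableEq E] [Algebra F E] (n : ℕ) :
    (Finset.univ.image (fun x : F => eval x (dickson 1 1 n))).image (algebraMap F E) =
      (nthRootsFinset ((Fintype.card F - 1) / n.gcd (Fintype.card F - 1)) (1 : E) ∪
        nthRootsFinset ((Fintype.card F + 1) / n.gcd (Fintype.card F + 1)) 1).image
          (fun v => v + v⁻¹) := by
  have h1 : 1 < Fintype.card F := Fintype.one_lt_card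
  have hM : 0 < Fintype.card F - 1 := by omega
  have hP : 0 < Fintype.card F + 1 := by omega
  have hA := Nat.div_pos (Nat.le_of_dvd hM (Nat.gcd_dvd_right n _)) (Nat.gcd_pos_of_pos_right n hM)
  have hB := Nat.div_pos (Nat.le_of_dvd hP (Nat.gcd_dvd_right n _)) (Nat.gcd_pos_of_pos_right n hP)
  have heval (x : F) (u : E) (hu : u ≠ 0) (h : algebraMap F E x = u + u⁻¹) :
      algebraMap F E (eval x (dickson 1 1 n)) = u ^ n + (u ^ n)⁻¹ := by
    rw [← inv_pow, ← dickson_one_one_eval_add_inv _ _ (mul_inv_cancel₀ hu), ← h,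
      ← map_one (algebraMap F E), ← map_dickson, eval_map_apply]
  ext y
  simp only [Finset.mem_image, Finset.mem_univ, true_and, exists_exists_eq_and, Finset.mem_union,
    mem_nthRootsFinset hA, mem_nthRootsFinset hB, ← exists_pow_eq_and_pow_eq_one_iff hM,
    ← exists_pow_eq_and_pow_eq_one_iff hP]
  constructor
  · rintro ⟨x, rfl⟩
    obtain ⟨u, hu0, hu⟩ : ∃ u : E, u ≠ 0 ∧ algebraMap F E x = u + u⁻¹ := by
      obtain ⟨u, hu⟩ := IsAlgClosed.exists_root (X ^ 2 - C (algebraMap F E x) * X + 1 : E[X])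
        (by
          have : (X ^ 2 - C (algebraMap F E x) * X + 1 : E[X]).degree = 2 := by compute_degree!
          rw [this]; decide)
      simp only [IsRoot, eval_add, eval_sub, eval_pow, eval_X, eval_mul, eval_C, eval_one] at hu
      have hu0 : u ≠ 0 := by rintro rfl; simp at hu
      refine ⟨u, hu0, ?_⟩
      field_simp
      linear_combination -hu
    refine ⟨u ^ n, ?_, (heval x u hu0 hu).symm⟩
    rcases (add_inv_mem_range_iff hu0).1 ⟨x, hu⟩ with h | h
    · exact Or.inl ⟨u, h, rfl⟩
    · exact Or.inr ⟨u, h, rfl⟩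
  · rintro ⟨v, h, rfl⟩
    obtain ⟨u, hu, rfl⟩ : ∃ u : E, (u ^ (Fintype.card F - 1) = 1 ∨ u ^ (Fintype.card F + 1) = 1) ∧
        u ^ n = v := by
      rcases h with ⟨u, h, h'⟩ | ⟨u, h, h'⟩
      · exact ⟨u, Or.inl h, h'⟩
      · exact ⟨u, Or.inr h, h'⟩
    have hu0 : u ≠ 0 := by rintro rfl; simp [hM.ne'] at hu
    obtain ⟨x, hx⟩ := (add_inv_mem_range_iff hu0).2 hu
    exact ⟨x, heval x u hu0 hx⟩

theorem eval_dickson_one_sq {R : Type*} [CommRing R] (b x : R) (n : ℕ) :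
    eval (b * x) (dickson 1 (b ^ 2) n) = b ^ n * eval x (dickson 1 1 n) := by
  induction n using Nat.twoStepInduction with
  | zero => simp
  | one => simp
  | more n h0 h1 =>
    simp only [dickson_add_two, eval_sub, eval_mul, eval_X, eval_C, h0, h1]
    ring

theorem odd_div_gcd_iff {n N k : ℕ} (hN : 2 ^ k ∣ N) (hN' : ¬ 2 ^ (k + 1) ∣ N) :
    Odd (N / n.gcd N) ↔ 2 ^ k ∣ n := by
  have hmul := Nat.mul_div_cancel' (Nat.gcd_dvd_right n N)
  constructor
  · intro h
    have : 2 ^ k ∣ n.gcd N :=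
      Nat.Coprime.dvd_of_dvd_mul_right (Nat.Coprime.pow_left k (Nat.coprime_two_left.2 h))
        (hmul.symm ▸ hN)
    exact this.trans (Nat.gcd_dvd_left n N)
  · intro h
    rw [← Nat.not_even_iff_odd, even_iff_two_dvd]
    intro h2
    apply hN'
    rw [← hmul, pow_succ]
    exact mul_dvd_mul (Nat.dvd_gcd h hN) h2

theorem odd_div_gcd_and_odd_div_gcd_iff {q n r : ℕ} (hq : Odd q) (hn : Even n)
    (hr : 2 ^ r ∣ q ^ 2 - 1) (hr' : ¬ 2 ^ (r + 1) ∣ q ^ 2 - 1) :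
    (Odd ((q - 1) / n.gcd (q - 1)) ∧ Odd ((q + 1) / n.gcd (q + 1))) ↔ 2 ^ (r - 1) ∣ n := by
  have hn2 : 2 ^ 1 ∣ n := by simpa using hn.two_dvd
  have hfac : q ^ 2 - 1 = (q + 1) * (q - 1) := by simpa using Nat.sq_sub_sq q 1
  have key : ∀ N m : ℕ, m % 4 = 2 → q ^ 2 - 1 = 2 * ((m / 2) * N) →
      ((Odd (N / n.gcd N) ∧ Odd (m / n.gcd m)) ↔ 2 ^ (r - 1) ∣ n) := by
    intro N m hm h
    rw [odd_div_gcd_iff (k := 1) (N := m) (by omega) (by omega)]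
    have hr0 : r ≠ 0 := by
      rintro rfl
      exact hr' (h ▸ ⟨_, by rw [pow_one]⟩)
    obtain ⟨s, rfl⟩ := Nat.exists_eq_succ_of_ne_zero hr0
    have hco : ∀ t, Nat.Coprime (2 ^ t) (m / 2) := fun t =>
      Nat.Coprime.pow_left t (Nat.coprime_two_left.2 (Nat.odd_iff.2 (by omega)))
    have hdiv : ∀ t, 2 ^ (t + 1) ∣ q ^ 2 - 1 ↔ 2 ^ t ∣ N := fun t => by
      rw [h, pow_succ', Nat.mul_dvd_mul_iff_left two_pos]
      exact ⟨(hco t).dvd_of_dvd_mul_left, fun h => h.mul_left _⟩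
    rw [Nat.succ_eq_add_one, hdiv] at hr hr'
    rw [odd_div_gcd_iff hr hr', Nat.succ_sub_one]
    exact and_iff_left hn2
  have hq2 := Nat.odd_iff.1 hq
  rcases (by omega : (q + 1) % 4 = 2 ∨ (q - 1) % 4 = 2) with h | h
  · refine key _ _ h ?_
    rw [hfac, ← mul_assoc, Nat.mul_div_cancel' (by omega)]
  · rw [and_comm]
    refine key _ _ h ?_
    rw [hfac, ← mul_assoc, Nat.mul_div_cancel' (by omega), mul_comm]

theorem coprime_div_gcd_div_gcd {q n : ℕ} (hq : Odd q) (hn : Even n) :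
    Nat.Coprime ((q - 1) / n.gcd (q - 1)) ((q + 1) / n.gcd (q + 1)) := by
  have hq2 := Nat.odd_iff.1 hq
  have hA : (q - 1) / n.gcd (q - 1) ∣ (q - 1) / 2 :=
    Nat.div_dvd_div_left (Nat.gcd_dvd_right _ _) (Nat.dvd_gcd hn.two_dvd (by omega))
  have hB : (q + 1) / n.gcd (q + 1) ∣ (q + 1) / 2 :=
    Nat.div_dvd_div_left (Nat.gcd_dvd_right _ _) (Nat.dvd_gcd hn.two_dvd (by omega))
  refine Nat.Coprime.of_dvd hA hB ?_
  rw [show (q + 1) / 2 = (q - 1) / 2 + 1 by omega]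
  simp

end DicksonResidueSum

open DicksonResidueSum

/-- Closed form for the residue sum of `D_n(x,a)` when `a` is a nonzero square. -/
theorem dickson_residue_sum_square {F : Type*} [Field F] [Fintype F] [DecidableEq F]
    {q : ℕ} (hF : Fintype.card F = q) (hq : Odd q) (hq3 : 3 < q)
    (a : F) (ha : IsSquare a) (ha0 : a ≠ 0) (n : ℕ) (hn : Even n)
    (d δ r : ℕ) (hd : d = Nat.gcd n (q - 1)) (hδ : δ = Nat.gcd n (q + 1))
    (hr : 2 ^ r ∣ q ^ 2 - 1 ∧ ¬ 2 ^ (r + 1) ∣ q ^ 2 - 1) :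
    ∑ y ∈ Finset.image (fun x : F => Polynomial.eval x (Polynomial.dickson 1 a n))
        Finset.univ, y =
      (if 2 ^ (r - 1) ∣ n then 0 else -(a ^ (n / 2))) +
      (if δ = q + 1 then a ^ (n / 2) else 0) +
      (if d = q - 1 then a ^ (n / 2) else 0) := by
  classical
  subst hd hδ hF
  set q := Fintype.card F with hqdef
  obtain ⟨b, rfl⟩ := ha
  rw [← sq] at ha0 ⊢
  have hb : b ≠ 0 := by rintro rfl; simp at ha0
  have hpow : (b ^ 2) ^ (n / 2) = b ^ n := by rw [← pow_mul, Nat.mul_div_cancel' hn.two_dvd]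
  have himg : Finset.univ.image (fun x : F => eval x (dickson 1 (b ^ 2) n)) =
      (Finset.univ.image (fun x : F => eval x (dickson 1 1 n))).image (b ^ n * ·) := by
    ext y
    simp only [Finset.mem_image, Finset.mem_univ, true_and, exists_exists_eq_and,
      ← eval_dickson_one_sq]
    exact ((Equiv.mulLeft₀ b hb).surjective.exists
      (p := fun x => eval x (dickson 1 (b ^ 2) n) = y)).trans (by simp)
  rw [himg, Finset.sum_image (fun x _ y _ h => mul_left_cancel₀ (pow_ne_zero n hb) h),
    ← Finset.mul_sum, hpow]
  obtain ⟨E, _, _, _⟩ : ∃ (E : Type _) (_ : Field E) (_ : Algebra F E), IsAlgClosed E :=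
    ⟨AlgebraicClosure F, inferInstance, inferInstance, inferInstance⟩
  have hqE : ((q : ℕ) : E) = 0 := by
    rw [← map_natCast (algebraMap F E), hqdef, FiniteField.cast_card_eq_zero, map_zero]
  have hMd := Nat.div_mul_cancel (Nat.gcd_dvd_right n (q - 1))
  have hPd := Nat.div_mul_cancel (Nat.gcd_dvd_right n (q + 1))
  have hA : (((q - 1) / n.gcd (q - 1) : ℕ) : E) ≠ 0 := by
    intro h
    have := congrArg (Nat.cast : ℕ → E) hMd
    rw [Nat.cast_mul, h, zero_mul, Nat.cast_sub (by omega), hqE] at this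
    simp at this
  have hB : (((q + 1) / n.gcd (q + 1) : ℕ) : E) ≠ 0 := by
    intro h
    have := congrArg (Nat.cast : ℕ → E) hPd
    rw [Nat.cast_mul, h, zero_mul, Nat.cast_add, hqE] at this
    simp at this
  have h2 : (2 : E) ≠ 0 := by
    intro h
    obtain ⟨k, hk⟩ := hq
    rw [hk] at hqE
    simp [h] at hqE
  have hone (N : ℕ) (hN : 0 < N) : N / n.gcd N = 1 ↔ n.gcd N = N := by
    rw [Nat.div_eq_iff_eq_mul_left (Nat.gcd_pos_of_pos_right n hN) (Nat.gcd_dvd_right n N), one_mul,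
      eq_comm]
  have hsum := sum_image_nthRootsFinset_union hA hB h2 (coprime_div_gcd_div_gcd hq hn)
  rw [← image_dickson_one, Finset.sum_image (fun x _ y _ h => (algebraMap F E).injective h),
    ← map_sum] at hsum
  simp only [odd_div_gcd_and_odd_div_gcd_iff hq hn hr.1 hr.2, hone _ (by omega : 0 < q - 1),
    hone _ (by omega : 0 < q + 1)] at hsum
  have hsumF : ∑ y ∈ Finset.univ.image (fun x : F => eval x (dickson 1 1 n)), y =
      (if 2 ^ (r - 1) ∣ n then 0 else -1) + (if n.gcd (q + 1) = q + 1 then 1 else 0) +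
        (if n.gcd (q - 1) = q - 1 then 1 else 0) := by
    apply (algebraMap F E).injective
    rw [hsum]
    simp [apply_ite (algebraMap F E)]
  rw [hsumF]
  simp only [mul_add, mul_ite, mul_zero, mul_one, mul_neg]
end
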